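/- Every nonsolvable finite group of order at most $84$ is isomorphic to the alternating group $A_5$. -/

import Mathlib

open Subgroup in
theorem sylow_facts {G : Type*} [Group G] [Finite G] (hns : ¬ Group.IsSolvable G)
    (hs : ∀ N : Subgroup G, N.Normal → N = ⊥ ∨ N = ⊤)
    (p k q : ℕ) (hp : p.Prime) (hk : k ≠ 0) (hq : ¬ p ∣ q) (hc : Nat.card G = p ^ k * q) :
    Nat.card (Sylow p G) ∣ q ∧ Nat.card (Sylow p G) % p = 1 ∧ Nat.card (Sylow p G) ≠ 1 ∧
    (k ≤ 2 → Nat.card (Sylow p G) ≠ q) ∧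
    Function.Injective (MulAction.toPermHom G (Sylow p G)) ∧
    Nat.card G ∣ (Nat.card (Sylow p G)).factorial := by
  have : Fact p.Prime := ⟨hp⟩
  have P : Sylow p G := default
  have hpd : p ∣ Nat.card G := hc ▸ Dvd.dvd.mul_right (dvd_pow_self p hk) q
  have hPc : Nat.card P = p ^ k := by
    rw [P.card_eq_multiplicity, hc]
    congr 1
    have hq0 : q ≠ 0 := by rintro rfl; simp at hq
    rw [Nat.factorization_mul (pow_ne_zero _ hp.ne_zero) hq0]
    simp [hp.factorization_self, Nat.factorization_eq_zero_of_not_dvd hq]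
  have hPi : P.index = q := by
    have := P.index_mul_card
    have h2 : 0 < p ^ k := pow_pos hp.pos k
    rw [hc, mul_comm (p ^ k)] at this
    rw [show Nat.card (P : Subgroup G) = p ^ k from hPc] at this
    exact Nat.eq_of_mul_eq_mul_right h2 this
  have hPtop : (P : Subgroup G) ≠ ⊤ := by
    intro h
    apply hns
    have h1 : IsPGroup p G := by
      have := P.isPGroup'
      rw [h] at this
      exact this.of_equiv Subgroup.topEquiv
    have := h1.isNilpotent
    infer_instance
  have hPbot : (P : Subgroup G) ≠ ⊥ := P.ne_bot_of_dvd_card hpd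
  have hn1 : Nat.card (Sylow p G) ≠ 1 := by
    intro h
    have := (Nat.card_eq_one_iff_unique.mp h).1
    rcases hs P P.normal_of_subsingleton with h | h
    · exact hPbot h
    · exact hPtop h
  have hinj : Function.Injective (MulAction.toPermHom G (Sylow p G)) := by
    rw [← MonoidHom.ker_eq_bot_iff]
    rcases hs (MulAction.toPermHom G (Sylow p G)).ker inferInstance with h | h
    · exact h
    · exfalso
      apply hn1
      rw [Nat.card_eq_one_iff_unique]
      refine ⟨⟨fun A B => ?_⟩, inferInstance⟩
      obtain ⟨g, rfl⟩ := MulAction.exists_smul_eq G A B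
      have hg : g ∈ (MulAction.toPermHom G (Sylow p G)).ker := h ▸ Subgroup.mem_top g
      rw [MonoidHom.mem_ker] at hg
      have := congrArg (fun e => e A) hg
      simpa using this.symm
  refine ⟨hPi ▸ P.card_dvd_index, ?_, hn1, ?_, hinj, ?_⟩
  · have := card_sylow_modEq_one p G
    rw [Nat.ModEq, Nat.mod_eq_of_lt hp.one_lt] at this
    exact this
  · intro hk2 hcq
    have hcomm : ∀ a b : P, a * b = b * a := by
      have : k = 1 ∨ k = 2 := by omega
      rcases this with rfl | rfl
      · have : IsCyclic P := isCyclic_of_prime_card (p := p) (by simpa using hPc)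
        exact fun a b => (IsCyclic.isMulCommutative (α := P)).is_comm.comm a b
      · exact (IsPGroup.isMulCommutative_of_card_eq_prime_sq hPc).is_comm.comm
    have hN : normalizer (P : Set G) = (P : Subgroup G) := by
      symm
      have hle : (P : Subgroup G) ≤ normalizer (P : Set G) := le_normalizer
      apply Subgroup.eq_of_le_of_card_ge hle
      have h1 := P.card_eq_index_normalizer
      rw [hcq, ← hPi] at h1
      have h2 := P.index_mul_card
      have h3 := (normalizer (P : Set G)).index_mul_card
      rw [← h1, ← h2] at h3
      exact (Nat.eq_of_mul_eq_mul_left (Nat.pos_of_ne_zero index_ne_zero_of_finite) h3).le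
    have hNC : normalizer (P : Set G) ≤ centralizer (P : Set G) := by
      rw [hN]
      intro x hx y hy
      exact congrArg Subtype.val (hcomm ⟨y, hy⟩ ⟨x, hx⟩)
    have hK := MonoidHom.not_dvd_card_ker_transferSylow P hNC
    have hK2 := (MonoidHom.ker_transferSylow_isComplement' P hNC).index_eq_card
    rcases hs (MonoidHom.transferSylow P hNC).ker inferInstance with h | h
    · rw [h] at hK2
      simp at hK2
      exact hPtop hK2
    · rw [h] at hK
      simp at hK
      exact hK hpd
  · rw [← Nat.card_perm]
    exact Subgroup.card_dvd_of_injective _ hinj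

theorem key_contra {G : Type*} [Group G] [Finite G] (hns : ¬ Group.IsSolvable G)
    (hs : ∀ N : Subgroup G, N.Normal → N = ⊥ ∨ N = ⊤)
    (p k q : ℕ) (hp : p.Prime) (hk : k ≠ 0) (hq : ¬ p ∣ q) (hc : Nat.card G = p ^ k * q)
    (h : ∀ m ∈ q.divisors, m % p = 1 → m ≠ 1 → (k ≤ 2 → m ≠ q) → ¬ p ^ k * q ∣ m.factorial) :
    False := by
  obtain ⟨h1, h2, h3, h4, -, h5⟩ := sylow_facts hns hs p k q hp hk hq hc
  refine h _ (Nat.mem_divisors.mpr ⟨h1, ?_⟩) h2 h3 h4 (hc ▸ h5)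
  rintro rfl
  simp at hq

theorem simple_case {G : Type*} [Group G] [Finite G] (hns : ¬ Group.IsSolvable G)
    (hs : ∀ N : Subgroup G, N.Normal → N = ⊥ ∨ N = ⊤) (h60 : Nat.card G = 60) :
    Nonempty (G ≃* alternatingGroup (Fin 5)) := by
  obtain ⟨h1, h2, h3, h4, hinj, h5⟩ :=
    sylow_facts hns hs 2 2 15 Nat.prime_two (by decide) (by decide) (by rw [h60]; norm_num)
  have hm : Nat.card (Sylow 2 G) = 5 := by
    have hle := Nat.le_of_dvd (by decide) h1
    rw [h60] at h5
    generalize Nat.card (Sylow 2 G) = m at *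
    interval_cases m <;> simp_all [Nat.factorial]
  let e : Sylow 2 G ≃ Fin 5 := Finite.equivFinOfCardEq hm
  let f : G →* Equiv.Perm (Fin 5) :=
    (e.permCongrHom : _ →* _).comp (MulAction.toPermHom G (Sylow 2 G))
  have hf : Function.Injective f := e.permCongrHom.injective.comp hinj
  have e2 : G ≃* f.range := MonoidHom.ofInjective hf
  have hidx : f.range.index = 2 := by
    have := f.range.index_mul_card
    rw [← Nat.card_congr e2.toEquiv, h60, Nat.card_perm] at this
    simp [Nat.factorial] at this
    omega
  have hA := Equiv.Perm.eq_alternatingGroup_of_index_eq_two hidx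
  exact ⟨e2.trans (MulEquiv.subgroupCongr hA)⟩

set_option synthInstance.maxHeartbeats 400000 in
set_option synthInstance.maxSize 4096 in
theorem simple_card {G : Type*} [Group G] [Finite G] (hns : ¬ Group.IsSolvable G)
    (hs : ∀ N : Subgroup G, N.Normal → N = ⊥ ∨ N = ⊤) (hcard : Nat.card G ≤ 84) :
    Nat.card G = 60 := by
  by_contra h60
  have hsq : ¬ Squarefree (Nat.card G) := by
    intro h
    have := IsZGroup.of_squarefree h
    exact hns inferInstance
  have key := key_contra hns hs
  have hpos : 0 < Nat.card G := Nat.card_pos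
  generalize Nat.card G = n at *
  replace hcard : n < 85 := by omega
  have aux : 0 < n → n = 60 ∨ Squarefree n ∨ ∃ p ∈ [2, 3, 5, 7, 11, 13, 17, 19], ∃ k ∈ [1, 2, 3, 4, 5, 6],
      ¬ p ∣ n / p ^ k ∧ n = p ^ k * (n / p ^ k) ∧
      ∀ m ∈ (n / p ^ k).divisors, m % p = 1 → m ≠ 1 → (k ≤ 2 → m ≠ n / p ^ k) →
        ¬ p ^ k * (n / p ^ k) ∣ m.factorial := by
    clear key hsq h60
    clear hpos
    revert n
    decide +kernel
  rcases aux hpos with h | h | ⟨p, hp, k, hk, h1, h2, h3⟩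
  · exact h60 h
  · exact hsq h
  · refine key p k _ ?_ ?_ h1 h2 h3
    · simp at hp
      rcases hp with rfl | rfl | rfl | rfl | rfl | rfl | rfl | rfl <;> norm_num
    · rintro rfl
      simp at hk

theorem main_aux (n : ℕ) : ∀ (G : Type*) [Group G] [Finite G], Nat.card G = n →
    ¬ Group.IsSolvable G → Nat.card G ≤ 84 →
    Nat.card G = 60 ∧ ∀ N : Subgroup G, N.Normal → N = ⊥ ∨ N = ⊤ := by
  induction n using Nat.strong_induction_on with
  | _ n ih =>
  intro G _ _ hn hns hcard
  have hs : ∀ N : Subgroup G, N.Normal → N = ⊥ ∨ N = ⊤ := by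
    intro N hN
    by_contra! hcon
    have hmul := N.index_mul_card
    have hpos : 0 < Nat.card G := Nat.card_pos
    have c1 : 1 < Nat.card N := by
      rw [Subgroup.one_lt_card_iff_ne_bot]; exact hcon.1
    have c2 : 1 < N.index := by
      have : N.index ≠ 1 := fun h => hcon.2 (Subgroup.index_eq_one.mp h)
      have := N.index_ne_zero_of_finite
      omega
    have d1 : Nat.card N ≤ 42 := by nlinarith
    have d2 : N.index ≤ 42 := by nlinarith
    have l1 : Nat.card N < n := by nlinarith
    have l2 : N.index < n := by nlinarith
    apply hns
    rw [Group.isSolvable_iff_subgroup_quotient N]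
    constructor
    · by_contra h
      have := (ih _ l1 N rfl h (by omega)).1
      omega
    · by_contra h
      have := (ih _ l2 (G ⧸ N) rfl h (by rw [← Subgroup.index_eq_card]; omega)).1
      rw [← Subgroup.index_eq_card] at this
      omega
  exact ⟨simple_card hns hs hcard, hs⟩

theorem stmt_6 (G : Type*) [Group G] [Finite G] (hns : ¬ IsSolvable G)
    (hcard : Nat.card G ≤ 84) :
    Nonempty (G ≃* alternatingGroup (Fin 5)) := by
  obtain ⟨h1, h2⟩ := main_aux _ G rfl hns hcard
  exact simple_case hns h2 h1
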